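/- arXiv:math/9310221 — 2 statements merged into one kernel-verified Lean document; each statement's English description precedes it below -/
import Mathlib

section
/- Let 0<q<1, p=q^{1/2}, and let α,β be real with α,β>−1. For every integer ν≥0 and every x∈ℂ∖{0}: [(1−q^{α+2+ν})(1−q^{β+2+ν})·q^{ν+(α+β+4)/2}/((1−q^{ν+(α+β+3)/2})(1−q^{ν+(α+β+4)/2})²(1−q^{ν+(α+β+5)/2}))]·X_{ν+1}^{(α,β)}(x) = X_ν^{(α,β)}(x)·[x + ((1−q^{(β−α)/2})(1+q^{ν+(α+β+3)/2})/((1−q^{ν+(α+β+2)/2})(1−q^{ν+(α+β+4)/2})))·q^{(ν+α+3/2)/2}] + X_{ν−1}^{(α,β)}(x). -/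
open Finset Filter

/-- `rpw q t` is the complex number `q^t` (real power, `q > 0`). -/
noncomputable def rpw (q t : ℝ) : ℂ := ((q ^ t : ℝ) : ℂ)

/-- Finite q-shifted factorial `(a; qq)_n`. -/
noncomputable def qPoch (a qq : ℂ) (n : ℕ) : ℂ := ∏ j ∈ Finset.range n, (1 - a * qq ^ j)

/-- Infinite q-shifted factorial `(a; qq)_∞`. -/
noncomputable def qPochInf (a qq : ℂ) : ℂ := ∏' j : ℕ, (1 - a * qq ^ j)

/-- The function `X_ν^{(α,β)}(x)` (base `p`). -/
noncomputable def Xfun (p α β : ℝ) (ν : ℤ) (x : ℂ) : ℂ :=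
  (-x) ^ (-ν) *
  (qPochInf (rpw p (β + (ν : ℝ) + 2)) (p : ℂ) /
    qPochInf (rpw p (α + β + 2*(ν : ℝ) + 4)) (p : ℂ)) *
  ∑' j : ℕ,
    (qPoch (rpw p (α + (ν : ℝ) + 2)) (p : ℂ) j * qPoch (rpw p (1/2) / x) (p : ℂ) j /
      qPoch (p : ℂ) (p : ℂ) j) *
    qPochInf (-(rpw p (α + (ν : ℝ) + 5/2 + (j : ℝ))) / x) (p : ℂ) *
    rpw p ((β + (ν : ℝ) + 2) * (j : ℝ))

theorem multipliable_one_sub_mul_pow (c : ℂ) {p : ℂ} (hp : ‖p‖ < 1) :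
    Multipliable fun j : ℕ ↦ 1 - c * p ^ j := by
  simp only [sub_eq_add_neg]
  apply multipliable_one_add_of_summable
  simpa [norm_mul, norm_pow] using
    (summable_geometric_of_lt_one (norm_nonneg p) hp).mul_left ‖c‖

theorem qPochInf_eq_mul (c : ℂ) {p : ℂ} (hp : ‖p‖ < 1) :
    qPochInf c p = (1 - c) * qPochInf (c * p) p := by
  have h : (fun j : ℕ ↦ 1 - c * p ^ (j + 1)) = fun j ↦ 1 - c * p * p ^ j := by
    funext j; ring
  unfold qPochInf
  rw [tprod_eq_zero_mul' (f := fun j : ℕ ↦ 1 - c * p ^ j)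
    (by rw [h]; exact multipliable_one_sub_mul_pow _ hp), h, pow_zero, mul_one]

theorem qPochInf_ne_zero {c p : ℂ} (hp : ‖p‖ < 1) (hc : ‖c‖ < 1) : qPochInf c p ≠ 0 := by
  unfold qPochInf
  simp only [sub_eq_add_neg]
  refine tprod_one_add_ne_zero_of_summable (fun j h ↦ ?_) ?_
  · have h1 : c * p ^ j = 1 := by linear_combination -h
    have h2 : ‖c * p ^ j‖ < 1 := by
      rw [norm_mul, norm_pow]
      exact (mul_le_of_le_one_right (norm_nonneg _)
        (pow_le_one₀ (norm_nonneg _) hp.le)).trans_lt hc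
    simp [h1] at h2
  · simpa [norm_mul, norm_pow] using
      (summable_geometric_of_lt_one (norm_nonneg p) hp).mul_left ‖c‖

theorem qPoch_succ (a p : ℂ) (n : ℕ) : qPoch a p (n + 1) = qPoch a p n * (1 - a * p ^ n) :=
  Finset.prod_range_succ _ _

theorem one_sub_mul_qPoch (a p : ℂ) (n : ℕ) :
    (1 - a) * qPoch (a * p) p n = qPoch a p n * (1 - a * p ^ n) := by
  rw [← qPoch_succ, qPoch, qPoch, Finset.prod_range_succ', pow_zero, mul_one, mul_comm]
  congr 1
  exact Finset.prod_congr rfl fun j _ ↦ by ring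

theorem qPoch_self_ne_zero {p : ℂ} (hp : ‖p‖ < 1) (n : ℕ) : qPoch p p n ≠ 0 := by
  refine Finset.prod_ne_zero_iff.2 fun j _ h ↦ ?_
  have h1 : p ^ (j + 1) = 1 := by linear_combination -h
  have h2 : ‖p ^ (j + 1)‖ < 1 := by
    rw [norm_pow]
    exact pow_lt_one₀ (norm_nonneg _) hp j.succ_ne_zero
  simp [h1] at h2

/-- The summand of the series defining `Xfun`, with `a = p^(α+ν+2)`, `b = p^(β+ν+2)` and
`z = p^(1/2)/x`. -/
noncomputable def phiTerm (a b z p : ℂ) (j : ℕ) : ℂ :=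
  qPoch a p j * qPoch z p j / qPoch p p j * qPochInf (-(a * z * p ^ j)) p * b ^ j

/-- The common factor of `phiTerm a b`, `phiTerm (a * p) (b * p)` and
`phiTerm (a * p ^ 2) (b * p ^ 2)`. -/
noncomputable def phiCore (a b z p : ℂ) (j : ℕ) : ℂ :=
  qPoch a p j * qPoch z p j / qPoch p p j * qPochInf (-(a * p ^ 2 * z * p ^ j)) p * b ^ j

theorem phiTerm_eq (a b z : ℂ) {p : ℂ} (hp : ‖p‖ < 1) (j : ℕ) :
    phiTerm a b z p j =
      phiCore a b z p j * ((1 + a * z * p ^ j) * (1 + a * p * z * p ^ j)) := by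
  unfold phiTerm phiCore
  rw [qPochInf_eq_mul (-(a * z * p ^ j)) hp, qPochInf_eq_mul (-(a * z * p ^ j) * p) hp,
    show -(a * z * p ^ j) * p * p = -(a * p ^ 2 * z * p ^ j) by ring]
  ring

theorem one_sub_mul_phiTerm (a b z : ℂ) {p : ℂ} (hp : ‖p‖ < 1) (j : ℕ) :
    (1 - a) * phiTerm (a * p) (b * p) z p j =
      phiCore a b z p j * (p ^ j * (1 - a * p ^ j) * (1 + a * p * z * p ^ j)) := by
  unfold phiTerm phiCore
  rw [qPochInf_eq_mul (-(a * p * z * p ^ j)) hp,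
    show -(a * p * z * p ^ j) * p = -(a * p ^ 2 * z * p ^ j) by ring, mul_pow]
  linear_combination (qPoch z p j / qPoch p p j * (1 + a * p * z * p ^ j) *
    qPochInf (-(a * p ^ 2 * z * p ^ j)) p * (b ^ j * p ^ j)) * one_sub_mul_qPoch a p j

theorem one_sub_mul_one_sub_mul_phiTerm (a b z p : ℂ) (j : ℕ) :
    (1 - a) * (1 - a * p) * phiTerm (a * p ^ 2) (b * p ^ 2) z p j =
      phiCore a b z p j * ((p ^ j) ^ 2 * (1 - a * p ^ j) * (1 - a * p * p ^ j)) := by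
  have h : (1 - a) * (1 - a * p) * qPoch (a * p ^ 2) p j =
      qPoch a p j * (1 - a * p ^ j) * (1 - a * p * p ^ j) := by
    have h1 := one_sub_mul_qPoch (a * p) p j
    rw [show a * p * p = a * p ^ 2 by ring] at h1
    linear_combination (1 - a) * h1 + (1 - a * p * p ^ j) * one_sub_mul_qPoch a p j
  unfold phiTerm phiCore
  rw [mul_pow, ← pow_mul, mul_comm 2 j, pow_mul]
  linear_combination (qPoch z p j / qPoch p p j *
    qPochInf (-(a * p ^ 2 * z * p ^ j)) p * (b ^ j * (p ^ j) ^ 2)) * h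

theorem phiCore_succ (a b z : ℂ) {p : ℂ} (hp : ‖p‖ < 1) (j : ℕ) :
    phiCore a b z p (j + 1) * ((1 - p * p ^ j) * (1 + a * p ^ 2 * z * p ^ j)) =
      phiCore a b z p j * (b * (1 - a * p ^ j) * (1 - z * p ^ j)) := by
  have h1 := qPoch_self_ne_zero hp j
  have h2 := qPoch_self_ne_zero hp (j + 1)
  rw [qPoch_succ] at h2
  have h3 := right_ne_zero_of_mul h2
  unfold phiCore
  rw [qPochInf_eq_mul (-(a * p ^ 2 * z * p ^ j)) hp, qPoch_succ, qPoch_succ, qPoch_succ,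
    show -(a * p ^ 2 * z * p ^ (j + 1)) = -(a * p ^ 2 * z * p ^ j) * p by ring]
  rw [pow_succ b]
  generalize 1 - p * p ^ j = D at h3 ⊢
  field_simp
  ring

theorem summable_phiCore (a z : ℂ) {b p : ℂ} (hp : ‖p‖ < 1) (hb : ‖b‖ < 1) :
    Summable (phiCore a b z p) := by
  obtain ⟨r, hbr, hr⟩ := exists_between hb
  refine summable_of_ratio_norm_eventually_le hr ?_
  have hpow : Tendsto (fun j : ℕ ↦ p ^ j) atTop (nhds 0) :=
    tendsto_pow_atTop_nhds_zero_of_norm_lt_one hp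
  have hl : Tendsto (fun j : ℕ ↦ r * ‖(1 - p * p ^ j) * (1 + a * p ^ 2 * z * p ^ j)‖) atTop
      (nhds r) := by
    have : Continuous fun Q : ℂ ↦ r * ‖(1 - p * Q) * (1 + a * p ^ 2 * z * Q)‖ := by fun_prop
    simpa [Function.comp_def] using (this.tendsto 0).comp hpow
  have hd : Tendsto (fun j : ℕ ↦ ‖(1 - p * p ^ j) * (1 + a * p ^ 2 * z * p ^ j)‖) atTop
      (nhds 1) := by
    have : Continuous fun Q : ℂ ↦ ‖(1 - p * Q) * (1 + a * p ^ 2 * z * Q)‖ := by fun_prop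
    simpa [Function.comp_def] using (this.tendsto 0).comp hpow
  have hn : Tendsto (fun j : ℕ ↦ ‖b * (1 - a * p ^ j) * (1 - z * p ^ j)‖) atTop
      (nhds ‖b‖) := by
    have : Continuous fun Q : ℂ ↦ ‖b * (1 - a * Q) * (1 - z * Q)‖ := by fun_prop
    simpa [Function.comp_def] using (this.tendsto 0).comp hpow
  filter_upwards [hn.eventually_lt hl hbr, hd.eventually_const_lt zero_lt_one] with j h1 h2
  have h := congrArg norm (phiCore_succ a b z hp j)
  rw [norm_mul, norm_mul (phiCore a b z p j)] at h
  refine le_of_mul_le_mul_right ?_ h2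
  rw [h]
  calc _ ≤ ‖phiCore a b z p j‖ * (r * ‖(1 - p * p ^ j) * (1 + a * p ^ 2 * z * p ^ j)‖) := by
        gcongr
    _ = _ := by ring

theorem summable_phiCore_mul (a z : ℂ) {b p : ℂ} (hp : ‖p‖ < 1) (hb : ‖b‖ < 1)
    {f : ℂ → ℂ} (hf : Continuous f) :
    Summable fun j ↦ phiCore a b z p j * f (p ^ j) := by
  obtain ⟨C, hC⟩ := (isCompact_closedBall (0 : ℂ) 1).exists_bound_of_continuousOn
    hf.continuousOn
  refine Summable.of_norm_bounded ((summable_phiCore a z hp hb).norm.mul_right C) fun j ↦ ?_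
  rw [norm_mul]
  gcongr
  refine hC _ ?_
  rw [mem_closedBall_zero_iff, norm_pow]
  exact pow_le_one₀ (norm_nonneg _) hp.le

theorem tsum_succ_sub_eq {G : ℕ → ℂ} (hG : Summable G) :
    ∑' j, (G (j + 1) - G j) = -G 0 := by
  rw [((summable_nat_add_iff 1).2 hG).tsum_sub hG, hG.tsum_eq_zero_add]
  ring

theorem tsum_phiTerm_contiguous (a z : ℂ) {b p : ℂ} (hp : ‖p‖ < 1) (hb : ‖b‖ < 1)
    (ha : 1 - a ≠ 0) (hap : 1 - a * p ≠ 0) (h0 : 1 - a * b ≠ 0)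
    (h1 : 1 - a * b * p ≠ 0) (h2 : 1 - a * b * p ^ 2 ≠ 0) :
    (1 - a ^ 2 * p ^ 2) * (1 + b * p) * (a * b * p) * z ^ 2 /
        ((1 - a * b * p) * (1 - a * b * p ^ 2)) *
          ∑' j, phiTerm (a * p ^ 2) (b * p ^ 2) z p j +
      (1 + (a - b) * (1 + a * b * p) * z / ((1 - a * b) * (1 - a * b * p ^ 2))) *
          ∑' j, phiTerm (a * p) (b * p) z p j -
      (1 - b) / ((1 - a * b) * (1 - a * b * p)) * ∑' j, phiTerm a b z p j = 0 := by
  have s0 : Summable (phiTerm a b z p) := by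
    rw [funext (phiTerm_eq a b z hp)]
    exact summable_phiCore_mul a z hp hb
      (f := fun Q ↦ (1 + a * z * Q) * (1 + a * p * z * Q)) (by fun_prop)
  have s1 : Summable (phiTerm (a * p) (b * p) z p) := by
    rw [← summable_mul_left_iff ha, funext (one_sub_mul_phiTerm a b z hp)]
    exact summable_phiCore_mul a z hp hb
      (f := fun Q ↦ Q * (1 - a * Q) * (1 + a * p * z * Q)) (by fun_prop)
  have s2 : Summable (phiTerm (a * p ^ 2) (b * p ^ 2) z p) := by
    rw [← summable_mul_left_iff (mul_ne_zero ha hap),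
      funext (one_sub_mul_one_sub_mul_phiTerm a b z p)]
    exact summable_phiCore_mul a z hp hb
      (f := fun Q ↦ Q ^ 2 * (1 - a * Q) * (1 - a * p * Q)) (by fun_prop)
  set R : ℂ → ℂ := fun Q ↦ 1 / ((1 - a * b) * (1 - a * b * p)) -
    a / ((1 - a) * (1 - a * b * p)) * (1 + a * (1 - b) * z / (1 - a * b) +
      b * p * z * (1 + a * p) / (1 - a * b * p ^ 2)) * Q +
    a ^ 2 * b * p * z * (1 + a * p) /
      ((1 - a) * (1 - a * b * p) * (1 - a * b * p ^ 2)) * Q ^ 2 with hR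
  set G : ℕ → ℂ := fun j ↦
    phiCore a b z p j * (R (p ^ j) * (1 - p ^ j) * (1 + a * p * z * p ^ j)) with hG
  have sG : Summable G := summable_phiCore_mul a z hp hb
    (f := fun Q ↦ R Q * (1 - Q) * (1 + a * p * z * Q)) (by fun_prop)
  rw [← tsum_mul_left, ← tsum_mul_left, ← tsum_mul_left,
    ← (s2.mul_left _).tsum_add (s1.mul_left _),
    ← ((s2.mul_left _).add (s1.mul_left _)).tsum_sub (s0.mul_left _)]
  have hG0 : -G 0 = 0 := by simp [hG]
  rw [← hG0, ← tsum_succ_sub_eq sG]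
  refine tsum_congr fun j ↦ ?_
  have e2 := one_sub_mul_one_sub_mul_phiTerm a b z p j
  have e1 := one_sub_mul_phiTerm a b z hp j
  rw [mul_comm, ← eq_div_iff (mul_ne_zero ha hap)] at e2
  rw [mul_comm, ← eq_div_iff ha] at e1
  have eG : G (j + 1) = phiCore a b z p j *
      (R (p * p ^ j) * b * (1 - a * p ^ j) * (1 - z * p ^ j)) := by
    simp only [hG, pow_succ']
    linear_combination R (p * p ^ j) * phiCore_succ a b z hp j
  rw [eG, e2, e1, phiTerm_eq a b z hp j]
  simp only [hG, hR]
  generalize p ^ j = Q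
  generalize phiCore a b z p j = T
  have key : (1 - a ^ 2 * p ^ 2) * (1 + b * p) * (a * b * p) * z ^ 2 /
        ((1 - a * b * p) * (1 - a * b * p ^ 2)) *
          (Q ^ 2 * (1 - a * Q) * (1 - a * p * Q) / ((1 - a) * (1 - a * p))) +
      (1 + (a - b) * (1 + a * b * p) * z / ((1 - a * b) * (1 - a * b * p ^ 2))) *
          (Q * (1 - a * Q) * (1 + a * p * z * Q) / (1 - a)) -
      (1 - b) / ((1 - a * b) * (1 - a * b * p)) * ((1 + a * z * Q) * (1 + a * p * z * Q)) =
      R (p * Q) * b * (1 - a * Q) * (1 - z * Q) - R Q * (1 - Q) * (1 + a * p * z * Q) := by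
    simp only [hR]
    generalize hdA : 1 - a = dA at ha ⊢
    generalize hdAp : 1 - a * p = dAp at hap ⊢
    generalize hd0 : 1 - a * b = d0 at h0 ⊢
    generalize hd1 : 1 - a * b * p = d1 at h1 ⊢
    generalize hd2 : 1 - a * b * p ^ 2 = d2 at h2 ⊢
    field_simp
    rw [← hdA, ← hdAp, ← hd0, ← hd1, ← hd2]
    ring
  simp only [hR] at key
  linear_combination T * key

theorem Xfun_eq {p : ℝ} (hp : 0 < p) (α β : ℝ) (ν : ℤ) (x a b : ℂ)
    (ha : rpw p (α + ν + 2) = a) (hb : rpw p (β + ν + 2) = b) :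
    Xfun p α β ν x = (-x) ^ (-ν) * (qPochInf b p / qPochInf (a * b) p) *
      ∑' j, phiTerm a b (rpw p (1 / 2) / x) p j := by
  have hab : rpw p (α + β + 2 * (ν : ℝ) + 4) = a * b := by
    rw [← ha, ← hb, rpw, rpw, rpw, ← Complex.ofReal_mul, ← Real.rpow_add hp]
    ring_nf
  unfold Xfun
  rw [hab, ha, hb]
  congr 1
  refine tsum_congr fun j ↦ ?_
  have h1 : rpw p ((β + (ν : ℝ) + 2) * (j : ℝ)) = b ^ j := by
    rw [← hb, rpw, rpw, ← Complex.ofReal_pow, Real.rpow_mul_natCast hp.le]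
  have h2 : rpw p (α + (ν : ℝ) + 5 / 2 + (j : ℝ)) = a * rpw p (1 / 2) * (p : ℂ) ^ j := by
    rw [← ha, rpw, rpw, rpw, ← Complex.ofReal_pow, ← Complex.ofReal_mul, ← Complex.ofReal_mul,
      ← Real.rpow_natCast, ← Real.rpow_add hp, ← Real.rpow_add hp]
    ring_nf
  rw [h1, h2, phiTerm]
  congr 3
  ring

theorem one_sub_ofReal_ne_zero {t : ℝ} (ht : t < 1) : (1 : ℂ) - (t : ℂ) ≠ 0 := by
  rw [← Complex.ofReal_one, ← Complex.ofReal_sub]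
  exact Complex.ofReal_ne_zero.2 (sub_pos.2 ht).ne'

theorem statement7 (q α β : ℝ) (hq0 : 0 < q) (hq1 : q < 1)
    (hα : -1 < α) (hβ : -1 < β)
    (p : ℝ) (hp : p = q ^ ((1 : ℝ)/2))
    (ν : ℕ) (x : ℂ) (hx : x ≠ 0) :
    ((1 - rpw q (α + 2 + (ν : ℝ))) * (1 - rpw q (β + 2 + (ν : ℝ))) *
       rpw q ((ν : ℝ) + (α + β + 4)/2) /
     ((1 - rpw q ((ν : ℝ) + (α + β + 3)/2)) * (1 - rpw q ((ν : ℝ) + (α + β + 4)/2))^2 *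
      (1 - rpw q ((ν : ℝ) + (α + β + 5)/2)))) * Xfun p α β ((ν : ℤ) + 1) x =
    Xfun p α β (ν : ℤ) x *
      (x + ((1 - rpw q ((β - α)/2)) * (1 + rpw q ((ν : ℝ) + (α + β + 3)/2)) /
        ((1 - rpw q ((ν : ℝ) + (α + β + 2)/2)) * (1 - rpw q ((ν : ℝ) + (α + β + 4)/2)))) *
        rpw q (((ν : ℝ) + α + 3/2)/2)) +
    Xfun p α β ((ν : ℤ) - 1) x := by
  have hp0 : 0 < p := hp ▸ Real.rpow_pos_of_pos hq0 _
  have hp1 : p < 1 := hp ▸ Real.rpow_lt_one hq0.le hq1 (by norm_num)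
  have hq : ∀ t : ℝ, rpw q t = ((p ^ (2 * t) : ℝ) : ℂ) := fun t ↦ by
    rw [rpw, hp, ← Real.rpow_mul hq0.le]
    ring_nf
  obtain ⟨A, hA⟩ : ∃ A : ℝ, A = p ^ (α + ν + 1) := ⟨_, rfl⟩
  obtain ⟨B, hB⟩ : ∃ B : ℝ, B = p ^ (β + ν + 1) := ⟨_, rfl⟩
  obtain ⟨s, hs⟩ : ∃ s : ℝ, s = p ^ (1 / 2 : ℝ) := ⟨_, rfl⟩
  have hν : (0 : ℝ) ≤ ν := Nat.cast_nonneg ν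
  have hA0 : 0 < A := hA ▸ Real.rpow_pos_of_pos hp0 _
  have hB0 : 0 < B := hB ▸ Real.rpow_pos_of_pos hp0 _
  have hs0 : 0 < s := hs ▸ Real.rpow_pos_of_pos hp0 _
  have hA1 : A < 1 := hA ▸ Real.rpow_lt_one hp0.le hp1 (by linarith)
  have hB1 : B < 1 := hB ▸ Real.rpow_lt_one hp0.le hp1 (by linarith)
  have hlA : Real.log A = (α + ν + 1) * Real.log p := by rw [hA, Real.log_rpow hp0]
  have hlB : Real.log B = (β + ν + 1) * Real.log p := by rw [hB, Real.log_rpow hp0]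
  have hls : Real.log s = 1 / 2 * Real.log p := by rw [hs, Real.log_rpow hp0]
  have hss : s ^ 2 = p := by
    rw [hs, ← Real.rpow_natCast, ← Real.rpow_mul hp0.le]
    norm_num
  have pw : ∀ (t y : ℝ), 0 < y → Real.log y = t * Real.log p → p ^ t = y := fun t y hy h ↦ by
    rw [Real.rpow_def_of_pos hp0, mul_comm, ← h, Real.exp_log hy]
  have nA := hA0.ne'
  have nB := hB0.ne'
  have ns := hs0.ne'
  have q1 : p ^ (2 * (α + 2 + (ν : ℝ))) = A ^ 2 * p ^ 2 :=
    pw _ _ (by positivity) (by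
      rw [Real.log_mul (by positivity) (by positivity), Real.log_pow, Real.log_pow, hlA]
      push_cast; ring)
  have q2 : p ^ (2 * (β + 2 + (ν : ℝ))) = B ^ 2 * p ^ 2 :=
    pw _ _ (by positivity) (by
      rw [Real.log_mul (by positivity) (by positivity), Real.log_pow, Real.log_pow, hlB]
      push_cast; ring)
  have qAB : ∀ (n : ℕ) (t : ℝ), 2 * t = α + β + 2 * ν + 2 + n →
      p ^ (2 * t) = A * B * p ^ n := fun n t h ↦
    pw _ _ (by positivity) (by
      rw [Real.log_mul (by positivity) (by positivity), Real.log_mul (by positivity)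
        (by positivity), Real.log_pow, hlA, hlB, h]
      ring)
  have q3 := qAB 2 ((ν : ℝ) + (α + β + 4) / 2) (by push_cast; ring)
  have q4 := qAB 1 ((ν : ℝ) + (α + β + 3) / 2) (by push_cast; ring)
  have q5 := qAB 3 ((ν : ℝ) + (α + β + 5) / 2) (by push_cast; ring)
  have q6 := qAB 0 ((ν : ℝ) + (α + β + 2) / 2) (by push_cast; ring)
  have q7 : p ^ (2 * ((β - α) / 2)) = B / A :=
    pw _ _ (by positivity) (by rw [Real.log_div nB nA, hlA, hlB]; ring)
  have q8 : p ^ (2 * (((ν : ℝ) + α + 3 / 2) / 2)) = A * s :=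
    pw _ _ (by positivity) (by rw [Real.log_mul nA ns, hlA, hls]; ring)
  have rp : ∀ (γ C : ℝ) (μ : ℤ) (n : ℕ), C = p ^ (γ + ν + 1) → (μ : ℝ) = ν + n - 1 →
      rpw p (γ + μ + 2) = (C : ℂ) * (p : ℂ) ^ n := fun γ C μ n hC hμ ↦ by
    rw [rpw, hC, hμ, ← Complex.ofReal_pow, ← Complex.ofReal_mul, ← Real.rpow_natCast,
      ← Real.rpow_add hp0]
    ring_nf
  rw [Xfun_eq hp0 α β ((ν : ℤ) + 1) x _ _ (rp α A _ 2 hA (by push_cast; ring))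
      (rp β B _ 2 hB (by push_cast; ring)),
    Xfun_eq hp0 α β (ν : ℤ) x _ _ (rp α A _ 1 hA (by push_cast; ring))
      (rp β B _ 1 hB (by push_cast; ring)),
    Xfun_eq hp0 α β ((ν : ℤ) - 1) x _ _ (rp α A _ 0 hA (by push_cast; ring))
      (rp β B _ 0 hB (by push_cast; ring))]
  simp only [hq, q1, q2, q3, q4, q5, q6, q7, q8]
  rw [show rpw p (1 / 2) = (s : ℂ) by rw [rpw, hs]]
  have hpn : ‖(p : ℂ)‖ < 1 := by
    rwa [Complex.norm_real, Real.norm_eq_abs, abs_of_pos hp0]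
  have hBn : ‖(B : ℂ)‖ < 1 := by
    rwa [Complex.norm_real, Real.norm_eq_abs, abs_of_pos hB0]
  have hlt : ∀ n : ℕ, A * B * p ^ n < 1 := fun n ↦
    mul_lt_one_of_nonneg_of_lt_one_left (by positivity)
      (mul_lt_one_of_nonneg_of_lt_one_left hA0.le hA1 hB1.le) (pow_le_one₀ hp0.le hp1.le)
  have d : ∀ n : ℕ, (1 : ℂ) - A * B * (p : ℂ) ^ n ≠ 0 := fun n ↦ by
    exact_mod_cast one_sub_ofReal_ne_zero (hlt n)
  have d0 : (1 : ℂ) - A * B ≠ 0 := by simpa using d 0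
  have d1 : (1 : ℂ) - A * B * p ≠ 0 := by simpa using d 1
  have dA : (1 : ℂ) - A ≠ 0 := one_sub_ofReal_ne_zero hA1
  have dAp : (1 : ℂ) - A * p ≠ 0 := by
    exact_mod_cast one_sub_ofReal_ne_zero
      (mul_lt_one_of_nonneg_of_lt_one_left hA0.le hA1 hp1.le)
  have key := tsum_phiTerm_contiguous (A : ℂ) ((s : ℂ) / x) hpn hBn dA dAp d0 d1 (d 2)
  have hW : qPochInf ((A : ℂ) * B * (p : ℂ) ^ 4) p ≠ 0 :=
    qPochInf_ne_zero hpn (by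
      rw [← Complex.ofReal_pow, ← Complex.ofReal_mul, ← Complex.ofReal_mul, Complex.norm_real,
        Real.norm_eq_abs, abs_of_pos (by positivity)]
      exact hlt 4)
  have w (n : ℕ) := qPochInf_eq_mul ((A : ℂ) * B * (p : ℂ) ^ n) hpn
  have v (n : ℕ) := qPochInf_eq_mul ((B : ℂ) * (p : ℂ) ^ n) hpn
  have hx1 : (-x) ^ (-((ν : ℤ) + 1)) = (-x) ^ (-(ν : ℤ)) * (-x)⁻¹ := by
    rw [neg_add, zpow_add₀ (neg_ne_zero.2 hx), zpow_neg_one]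
  have hx2 : (-x) ^ (-((ν : ℤ) - 1)) = (-x) ^ (-(ν : ℤ)) * (-x) := by
    rw [neg_sub, sub_eq_neg_add, zpow_add₀ (neg_ne_zero.2 hx), zpow_one]
  rw [hx1, hx2]
  have w0 := w 0
  have w1 := w 1
  have w2 := w 2
  have w3 := w 3
  have v0 := v 0
  have v1 := v 1
  simp only [mul_assoc _ ((p : ℂ) ^ _) (p : ℂ), ← pow_succ, zero_add,
    Nat.reduceAdd] at w0 w1 w2 w3 v0 v1
  have ab (n : ℕ) : (A : ℂ) * (p : ℂ) ^ n * (B * (p : ℂ) ^ n) = A * B * (p : ℂ) ^ (2 * n) := by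
    rw [two_mul, pow_add]; ring
  simp only [ab]
  norm_num only
  rw [w0, w1, w2, w3, v0, v1]
  simp only [pow_zero, pow_one, mul_one] at key ⊢
  generalize (-x) ^ (-(ν : ℤ)) = X
  generalize (∑' j, phiTerm ((A : ℂ) * (p : ℂ) ^ 2) (B * (p : ℂ) ^ 2) (s / x) p j) = S2 at key ⊢
  generalize (∑' j, phiTerm ((A : ℂ) * (p : ℂ)) (B * (p : ℂ)) (s / x) p j) = S1 at key ⊢
  generalize (∑' j, phiTerm (A : ℂ) B (s / x) p j) = S0 at key ⊢
  generalize qPochInf ((A : ℂ) * B * (p : ℂ) ^ 4) p = W at hW ⊢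
  generalize qPochInf ((B : ℂ) * (p : ℂ) ^ 2) p = V
  have hsC : (s : ℂ) ^ 2 = p := by exact_mod_cast hss
  have d2 := d 2
  have d3 := d 3
  have nAC : (A : ℂ) ≠ 0 := Complex.ofReal_ne_zero.2 nA
  push_cast
  rw [div_pow, hsC] at key
  linear_combination (norm := skip) (-(X * (1 - B * p) * V * x /
    ((1 - A * B * (p : ℂ) ^ 2) * (1 - A * B * (p : ℂ) ^ 3) * W))) * key
  generalize h0 : (1 : ℂ) - A * B = e0 at d0 ⊢
  generalize h1 : (1 : ℂ) - A * B * p = e1 at d1 ⊢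
  generalize h2 : (1 : ℂ) - A * B * (p : ℂ) ^ 2 = e2 at d2 ⊢
  generalize h3 : (1 : ℂ) - A * B * (p : ℂ) ^ 3 = e3 at d3 ⊢
  field_simp
  ring
end

section
/- Let 0<q<1 and let μ∈ℂ. Suppose f,g:ℂ→ℂ are entire functions, g is not identically zero, and both f and g satisfy, for all z∈ℂ∖{0}: F((q^{1/2}z+q^{−1/2}z^{−1})/2) − F((q^{−1/2}z+q^{1/2}z^{−1})/2) = μ·((q^{1/2}−q^{−1/2})(z−z^{−1})/2)·F((z+z^{−1})/2) (with F=f and F=g respectively). Then there exists c∈ℂ such that f(x)=c·g(x) for all x∈ℂ. In other words, for each μ the space of entire solutions of the Askey–Wilson eigenvalue equation 𝒟_q F = μ F is at most one-dimensional. -/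
open Finset Filter

/-- The `k`-th moment `∮ z ^ k * φ z` over the unit circle, a Laurent coefficient of `φ` up to a
factor `2 * π * I`. -/
noncomputable def circleMoment (φ : ℂ → ℂ) (k : ℤ) : ℂ := ∮ z in C(0, 1), z ^ k * φ z

theorem differentiableAt_zpow_mul {φ : ℂ → ℂ} (hφ : ∀ z ≠ 0, DifferentiableAt ℂ φ z) (k : ℤ)
    {z : ℂ} (hz : z ≠ 0) : DifferentiableAt ℂ (fun z => z ^ k * φ z) z :=
  (differentiableAt_zpow.2 (Or.inl hz)).mul (hφ z hz)

theorem circleIntegrable_zpow_mul {φ : ℂ → ℂ} (hφ : ∀ z ≠ 0, DifferentiableAt ℂ φ z) (k : ℤ) :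
    CircleIntegrable (fun z => z ^ k * φ z) 0 1 := by
  refine ContinuousOn.circleIntegrable zero_le_one fun z hz => ?_
  refine (differentiableAt_zpow_mul hφ k ?_).continuousAt.continuousWithinAt
  exact Metric.ne_of_mem_sphere hz one_ne_zero

theorem circleIntegral_zpow_mul_eq_circleMoment {φ : ℂ → ℂ}
    (hφ : ∀ z ≠ 0, DifferentiableAt ℂ φ z) (k : ℤ) {r : ℝ} (hr : 0 < r) :
    (∮ z in C(0, r), z ^ k * φ z) = circleMoment φ k := by
  have key : ∀ {s R : ℝ}, 0 < s → s ≤ R →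
      (∮ z in C(0, R), z ^ k * φ z) = ∮ z in C(0, s), z ^ k * φ z := by
    intro s R hs hle
    refine Complex.circleIntegral_eq_of_differentiable_on_annulus_off_countable hs hle
      Set.countable_empty (fun z hz => ?_) fun z hz => ?_
    · refine (differentiableAt_zpow_mul hφ k ?_).continuousAt.continuousWithinAt
      rintro rfl
      exact hz.2 (Metric.mem_ball_self hs)
    · refine differentiableAt_zpow_mul hφ k ?_
      rintro rfl
      exact hz.1.2 (Metric.mem_closedBall_self hs.le)
  rcases le_total r 1 with h | h
  · exact (key hr h).symm
  · exact key one_pos h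

theorem circleMoment_comp_mul {φ : ℂ → ℂ} (hφ : ∀ z ≠ 0, DifferentiableAt ℂ φ z) (k : ℤ)
    {r : ℝ} (hr : 0 < r) :
    circleMoment (fun z => φ (r * z)) k = (r : ℂ) ^ (-(k + 1)) * circleMoment φ k := by
  have hr' : (r : ℂ) ≠ 0 := by exact_mod_cast hr.ne'
  rw [← circleIntegral_zpow_mul_eq_circleMoment hφ k hr, ← circleIntegral.integral_const_mul]
  refine intervalIntegral.integral_congr fun θ _ => ?_
  simp only [deriv_circleMap, circleMap_zero, smul_eq_mul, mul_zpow, Complex.ofReal_one, one_mul,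
    zpow_neg, zpow_add_one₀ hr']
  have : (r : ℂ) ^ k ≠ 0 := zpow_ne_zero _ hr'
  field_simp

theorem circleMoment_sub {φ ψ : ℂ → ℂ} (hφ : ∀ z ≠ 0, DifferentiableAt ℂ φ z)
    (hψ : ∀ z ≠ 0, DifferentiableAt ℂ ψ z) (k : ℤ) :
    circleMoment (fun z => φ z - ψ z) k = circleMoment φ k - circleMoment ψ k := by
  simp only [circleMoment, mul_sub]
  exact circleIntegral.integral_sub (circleIntegrable_zpow_mul hφ k)
    (circleIntegrable_zpow_mul hψ k)

theorem circleMoment_const_mul (φ : ℂ → ℂ) (c : ℂ) (k : ℤ) :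
    circleMoment (fun z => c * φ z) k = c * circleMoment φ k := by
  simp only [circleMoment, mul_left_comm _ c, circleIntegral.integral_const_mul]

theorem circleMoment_congr {φ ψ : ℂ → ℂ} (h : ∀ z ≠ 0, φ z = ψ z) (k : ℤ) :
    circleMoment φ k = circleMoment ψ k := by
  refine circleIntegral.integral_congr zero_le_one fun z hz => ?_
  simp only [h z (Metric.ne_of_mem_sphere hz one_ne_zero)]

theorem circleMoment_zpow_mul (φ : ℂ → ℂ) (j k : ℤ) :
    circleMoment (fun z => z ^ j * φ z) k = circleMoment φ (k + j) := by
  refine circleIntegral.integral_congr zero_le_one fun z hz => ?_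
  simp only [zpow_add₀ (Metric.ne_of_mem_sphere hz one_ne_zero), mul_assoc]

theorem tendsto_circleMoment_natCast {φ : ℂ → ℂ} (hφ : ∀ z ≠ 0, DifferentiableAt ℂ φ z) :
    Tendsto (fun n : ℕ => circleMoment φ n) atTop (nhds 0) := by
  have hcont : ContinuousOn φ (Metric.sphere 0 (1 / 2)) := fun z hz =>
    (hφ z (Metric.ne_of_mem_sphere hz (by norm_num))).continuousAt.continuousWithinAt
  obtain ⟨C, hC⟩ := (isCompact_sphere (0 : ℂ) (1 / 2)).exists_bound_of_continuousOn hcont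
  have hlim : Tendsto (fun n : ℕ => 2 * Real.pi * (1 / 2) * ((1 / 2 : ℝ) ^ n * C)) atTop
      (nhds 0) := by
    simpa using ((tendsto_pow_atTop_nhds_zero_of_lt_one (r := (1 / 2 : ℝ)) (by norm_num)
      (by norm_num)).mul_const C).const_mul (2 * Real.pi * (1 / 2))
  refine squeeze_zero_norm (fun n => ?_) hlim
  rw [← circleIntegral_zpow_mul_eq_circleMoment hφ n (r := 1 / 2) (by norm_num)]
  refine circleIntegral.norm_integral_le_of_norm_le_const (by norm_num) fun z hz => ?_
  rw [norm_mul, zpow_natCast, norm_pow, mem_sphere_zero_iff_norm.1 hz]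
  gcongr
  exact hC z hz

theorem eq_zero_of_circleMoment_eq_zero {φ : ℂ → ℂ} (hφ : ∀ z ≠ 0, DifferentiableAt ℂ φ z)
    (h : ∀ k, circleMoment φ k = 0) {z : ℂ} (hz : z ≠ 0) : φ z = 0 := by
  have : Fact (0 < 2 * Real.pi) := ⟨Real.two_pi_pos⟩
  have hr : 0 < ‖z‖ := norm_pos_iff.2 hz
  have hr' : (‖z‖ : ℂ) ≠ 0 := by exact_mod_cast hr.ne'
  let F : C(AddCircle (2 * Real.pi), ℂ) :=
    ⟨fun x => φ (‖z‖ * (AddCircle.toCircle x : ℂ)), by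
      refine continuous_iff_continuousAt.2 fun x => ?_
      refine ContinuousAt.comp (g := φ) (hφ _ (mul_ne_zero hr' (Circle.coe_ne_zero _))).continuousAt
        ?_
      have := AddCircle.continuous_toCircle (T := 2 * Real.pi)
      fun_prop⟩
  have hF : ∀ n, fourierCoeff F n = 0 := by
    intro n
    have hn := circleMoment_comp_mul hφ (-n - 1) hr
    rw [h, mul_zero, circleMoment, circleIntegral] at hn
    rw [fourierCoeff_eq_intervalIntegral _ _ 0, zero_add]
    refine smul_eq_zero_of_right _ ?_
    refine (mul_eq_zero.1 (?_ : Complex.I * _ = 0)).resolve_left Complex.I_ne_zero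
    rw [← intervalIntegral.integral_const_mul, ← hn]
    refine intervalIntegral.integral_congr fun θ _ => ?_
    have h1 : (AddCircle.toCircle (θ : AddCircle (2 * Real.pi)) : ℂ)
        = Complex.exp (θ * Complex.I) := by
      rw [AddCircle.toCircle_apply_mk, div_self Real.two_pi_pos.ne', one_mul, Circle.coe_exp]
    have h2 : (fourier (-n) (θ : AddCircle (2 * Real.pi)) : ℂ)
        = Complex.exp (θ * Complex.I) ^ (-n) := by
      rw [fourier_apply, AddCircle.toCircle_zsmul, Circle.coe_zpow, h1]
    have h3 := Complex.exp_ne_zero (θ * Complex.I)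
    simp only [F, ContinuousMap.coe_mk, h1, h2, deriv_circleMap, circleMap_zero, smul_eq_mul,
      Complex.ofReal_one, one_mul, zpow_sub_one₀ h3]
    field_simp
  have hsum : Summable (fourierCoeff F) := by
    rw [funext hF]
    exact summable_zero
  have hzero : F (z.arg : AddCircle (2 * Real.pi)) = 0 := by
    refine (has_pointwise_sum_fourier_series_of_summable hsum _).unique ?_
    simp [hF, hasSum_zero]
  simpa [F, AddCircle.toCircle_apply_mk, div_self Real.two_pi_pos.ne',
    Complex.norm_mul_exp_arg_mul_I] using hzero

theorem circleMoment_recurrence {φ : ℂ → ℂ} (hφ : ∀ z ≠ 0, DifferentiableAt ℂ φ z) {p : ℝ}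
    (hp : 0 < p) {B : ℂ}
    (h : ∀ z ≠ 0, φ (p * z) - φ ((p⁻¹ : ℝ) * z) = B * ((z - z⁻¹) * φ z)) (k : ℤ) :
    ((p : ℂ) ^ (-(k + 1)) - (p : ℂ) ^ (k + 1)) * circleMoment φ k
      = B * (circleMoment φ (k + 1) - circleMoment φ (k - 1)) := by
  have hscale : ∀ {r : ℝ}, 0 < r → ∀ z ≠ 0, DifferentiableAt ℂ (fun z => φ (r * z)) z := by
    intro r hr z hz
    have hr' : (r : ℂ) ≠ 0 := by exact_mod_cast hr.ne'
    exact (hφ _ (mul_ne_zero hr' hz)).comp z (by fun_prop)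
  have hshift : ∀ j : ℤ, ∀ z ≠ 0, DifferentiableAt ℂ (fun z => z ^ j * φ z) z :=
    fun j z hz => differentiableAt_zpow_mul hφ j hz
  have hcongr := circleMoment_congr (φ := fun z => φ (p * z) - φ ((p⁻¹ : ℝ) * z))
    (ψ := fun z => B * (z ^ (1 : ℤ) * φ z - z ^ (-1 : ℤ) * φ z))
    (fun z hz => by rw [h z hz, zpow_one, zpow_neg_one, sub_mul]) k
  rw [circleMoment_sub (hscale hp) (hscale (inv_pos.2 hp)), circleMoment_comp_mul hφ k hp,
    circleMoment_comp_mul hφ k (inv_pos.2 hp), circleMoment_const_mul,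
    circleMoment_sub (hshift 1) (hshift (-1)), circleMoment_zpow_mul, circleMoment_zpow_mul,
    ← sub_eq_add_neg] at hcongr
  rw [← hcongr, sub_mul]
  simp

theorem zpow_neg_sub_zpow_ne_zero {p : ℝ} (hp0 : 0 < p) (hp1 : p < 1) {n : ℤ} (hn : n ≠ 0) :
    (p : ℂ) ^ (-n) - (p : ℂ) ^ n ≠ 0 := by
  rw [sub_ne_zero]
  have : p ^ (-n) ≠ p ^ n := fun h => hn (by
    have := zpow_right_injective₀ hp0 hp1.ne h
    omega)
  exact_mod_cast this

/-- The Casoratian of two decaying sequences satisfying the same three-term recurrence vanishes. -/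
theorem casoratian_eq_zero {a b t : ℤ → ℂ} {B : ℂ} (ht : ∀ k, k ≠ -1 → t k ≠ 0)
    (ha : ∀ k, t k * a k = B * (a (k + 1) - a (k - 1)))
    (hb : ∀ k, t k * b k = B * (b (k + 1) - b (k - 1)))
    (ha0 : Tendsto (fun n : ℕ => a n) atTop (nhds 0))
    (hb0 : Tendsto (fun n : ℕ => b n) atTop (nhds 0)) :
    a (-1) * b 0 = a 0 * b (-1) := by
  by_cases hB : B = 0
  · have ha' : a 0 = 0 := by simpa [hB, ht 0 (by decide)] using ha 0
    have hb' : b 0 = 0 := by simpa [hB, ht 0 (by decide)] using hb 0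
    simp [ha', hb']
  have hstep : ∀ k : ℤ, a k * b (k + 1) - a (k + 1) * b k
      = -(a (k - 1) * b k - a k * b (k - 1)) := fun k =>
    mul_left_cancel₀ hB (by linear_combination b k * ha k - a k * hb k)
  have hnorm : ∀ n : ℕ, ‖a n * b (n + 1) - a (n + 1) * b n‖ = ‖a (-1) * b 0 - a 0 * b (-1)‖ := by
    intro n
    induction n with
    | zero =>
      rw [hstep, norm_neg]
      simp
    | succ n ih =>
      rw [hstep, norm_neg, ← ih]
      simp
  have ha1 := ha0.comp (tendsto_add_atTop_nat 1)
  have hb1 := hb0.comp (tendsto_add_atTop_nat 1)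
  have hlim := ((ha0.mul hb1).sub (ha1.mul hb0)).norm
  simp only [Function.comp_def, Nat.cast_add, Nat.cast_one, hnorm, mul_zero, sub_zero,
    norm_zero] at hlim
  exact sub_eq_zero.1 (norm_eq_zero.1 (tendsto_nhds_unique tendsto_const_nhds hlim))

theorem eq_zero_of_recurrence {a t : ℤ → ℂ} {B : ℂ} (ht : ∀ k, k ≠ -1 → t k ≠ 0)
    (ha : ∀ k, t k * a k = B * (a (k + 1) - a (k - 1))) (h1 : a (-1) = 0) (h0 : a 0 = 0) (k : ℤ) :
    a k = 0 := by
  by_cases hB : B = 0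
  · by_cases hk : k = -1
    · rw [hk, h1]
    · simpa [hB, ht k hk] using ha k
  suffices h : a k = 0 ∧ a (k - 1) = 0 from h.1
  induction k using Int.induction_on with
  | zero => exact ⟨h0, by simpa using h1⟩
  | succ n ih =>
    have := ha n
    rw [ih.1, ih.2] at this
    exact ⟨by simpa [hB] using this, by simpa using ih.1⟩
  | pred n ih =>
    have := ha (-n - 1)
    rw [ih.2, sub_add_cancel, ih.1] at this
    exact ⟨ih.2, by simpa [hB] using this⟩

theorem exists_joukowsky_eq (x : ℂ) : ∃ z : ℂ, z ≠ 0 ∧ (z + z⁻¹) / 2 = x := by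
  obtain ⟨s, hs⟩ := IsAlgClosed.exists_pow_nat_eq (x ^ 2 - 1) two_pos
  have hmul : (x + s) * (x - s) = 1 := by linear_combination -hs
  refine ⟨x + s, left_ne_zero_of_mul_eq_one hmul, ?_⟩
  rw [inv_eq_of_mul_eq_one_right hmul]
  ring

theorem differentiableAt_comp_joukowsky {F : ℂ → ℂ} (hF : Differentiable ℂ F) :
    ∀ z ≠ 0, DifferentiableAt ℂ (fun z => F ((z + z⁻¹) / 2)) z := fun z hz =>
  (hF _).comp z ((differentiableAt_id.add (differentiableAt_inv hz)).div_const 2)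

theorem eq_zero_of_circleMoment_joukowsky_eq_zero {F : ℂ → ℂ} (hF : Differentiable ℂ F)
    (h : ∀ k, circleMoment (fun z => F ((z + z⁻¹) / 2)) k = 0) (x : ℂ) : F x = 0 := by
  obtain ⟨z, hz, rfl⟩ := exists_joukowsky_eq x
  exact eq_zero_of_circleMoment_eq_zero (differentiableAt_comp_joukowsky hF) h hz

theorem circleMoment_joukowsky_recurrence {q : ℝ} (hq0 : 0 < q) {μ : ℂ} {F : ℂ → ℂ}
    (hF : Differentiable ℂ F)
    (heq : ∀ z : ℂ, z ≠ 0 →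
      F ((rpw q (1/2) * z + rpw q (-(1/2)) * z⁻¹)/2) -
        F ((rpw q (-(1/2)) * z + rpw q (1/2) * z⁻¹)/2) =
      μ * ((rpw q (1/2) - rpw q (-(1/2))) * (z - z⁻¹)/2) * F ((z + z⁻¹)/2)) (k : ℤ) :
    (((q ^ (1 / 2 : ℝ) : ℝ) : ℂ) ^ (-(k + 1)) - ((q ^ (1 / 2 : ℝ) : ℝ) : ℂ) ^ (k + 1)) *
        circleMoment (fun z => F ((z + z⁻¹) / 2)) k
      = μ * (rpw q (1/2) - rpw q (-(1/2))) / 2 *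
        (circleMoment (fun z => F ((z + z⁻¹) / 2)) (k + 1)
          - circleMoment (fun z => F ((z + z⁻¹) / 2)) (k - 1)) := by
  refine circleMoment_recurrence (differentiableAt_comp_joukowsky hF) (Real.rpow_pos_of_pos hq0 _)
    (fun z hz => ?_) k
  have hinv : rpw q (-(1/2)) = (rpw q (1/2))⁻¹ := by
    rw [rpw, rpw, Real.rpow_neg hq0.le, Complex.ofReal_inv]
  have h := heq z hz
  rw [hinv] at h ⊢
  simp only [Complex.ofReal_inv, mul_inv, inv_inv, ← rpw.eq_1]
  rw [h]
  ring

theorem statement14 (q : ℝ) (hq0 : 0 < q) (hq1 : q < 1) (μ : ℂ) (f g : ℂ → ℂ)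
    (hf : Differentiable ℂ f) (hg : Differentiable ℂ g)
    (hgne : ∃ x : ℂ, g x ≠ 0)
    (heqf : ∀ z : ℂ, z ≠ 0 →
      f ((rpw q (1/2) * z + rpw q (-(1/2)) * z⁻¹)/2) -
        f ((rpw q (-(1/2)) * z + rpw q (1/2) * z⁻¹)/2) =
      μ * ((rpw q (1/2) - rpw q (-(1/2))) * (z - z⁻¹)/2) * f ((z + z⁻¹)/2))
    (heqg : ∀ z : ℂ, z ≠ 0 →
      g ((rpw q (1/2) * z + rpw q (-(1/2)) * z⁻¹)/2) -
        g ((rpw q (-(1/2)) * z + rpw q (1/2) * z⁻¹)/2) =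
      μ * ((rpw q (1/2) - rpw q (-(1/2))) * (z - z⁻¹)/2) * g ((z + z⁻¹)/2)) :
    ∃ c : ℂ, ∀ x : ℂ, f x = c * g x := by
  have hp0 : 0 < q ^ (1 / 2 : ℝ) := Real.rpow_pos_of_pos hq0 _
  have hp1 : q ^ (1 / 2 : ℝ) < 1 := Real.rpow_lt_one hq0.le hq1 (by norm_num)
  have ht : ∀ k : ℤ, k ≠ -1 →
      ((q ^ (1 / 2 : ℝ) : ℝ) : ℂ) ^ (-(k + 1)) - ((q ^ (1 / 2 : ℝ) : ℝ) : ℂ) ^ (k + 1) ≠ 0 :=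
    fun k hk => zpow_neg_sub_zpow_ne_zero hp0 hp1 (by omega)
  have hφ := differentiableAt_comp_joukowsky hf
  have hψ := differentiableAt_comp_joukowsky hg
  have ha := circleMoment_joukowsky_recurrence hq0 hf heqf
  have hb := circleMoment_joukowsky_recurrence hq0 hg heqg
  have hW := casoratian_eq_zero ht ha hb (tendsto_circleMoment_natCast hφ)
    (tendsto_circleMoment_natCast hψ)
  set a := circleMoment (fun z => f ((z + z⁻¹) / 2))
  set b := circleMoment (fun z => g ((z + z⁻¹) / 2))
  obtain ⟨c, hc1, hc0⟩ : ∃ c, a (-1) = c * b (-1) ∧ a 0 = c * b 0 := by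
    by_cases h1 : b (-1) = 0
    · have h0 : b 0 ≠ 0 := fun h0 => hgne.elim fun x hx =>
        hx (eq_zero_of_circleMoment_joukowsky_eq_zero hg (eq_zero_of_recurrence ht hb h1 h0) x)
      exact ⟨a 0 / b 0, by field_simp; linear_combination hW, by field_simp⟩
    · exact ⟨a (-1) / b (-1), by field_simp, by field_simp; linear_combination -hW⟩
  have hab : ∀ k, a k - c * b k = 0 :=
    eq_zero_of_recurrence (a := fun k => a k - c * b k)
      (B := μ * (rpw q (1/2) - rpw q (-(1/2))) / 2) ht
      (fun k => by linear_combination ha k - c * hb k) (by rw [hc1, sub_self])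
      (by rw [hc0, sub_self])
  refine ⟨c, fun x => sub_eq_zero.1 ?_⟩
  refine eq_zero_of_circleMoment_joukowsky_eq_zero (F := fun x => f x - c * g x)
    (hf.sub (hg.const_mul c)) (fun k => ?_) x
  rw [circleMoment_sub hφ fun z hz => (hψ z hz).const_mul c, circleMoment_const_mul]
  exact hab k
end
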